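/- Let k be a positive rational number such that √k is irrational. Then there exists a positive constant C = C(k) such that for every nonempty finite interval I ⊆ ℤ, every a, b ∈ ℤ and every q ∈ ℕ, one has | (1/|I|) ∑_{n ∈ I} e( ((a + b√k)/q) · n⌊n√k⌋ ) − G_k(a, b, q) · F(b/(2q)) | ≤ C q² (1 + |b|) (1 + log|I|) |I|^{−1/2}. -/

import Mathlib

open MeasureTheory

/-- `e(x) = exp(2πix)`. -/
noncomputable def expc (x : ℝ) : ℂ := Complex.exp (2 * Real.pi * Complex.I * x)

/-- The arithmetic factor
`G_k(a,b,q) = 𝔼_{r,s ∈ [2qk₂]} e((a/q) r s + (b/(2qk₂))(k₁ r² + k₂ s²))` for `k = k₁/k₂`. -/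
noncomputable def Gfactor (k₁ k₂ : ℕ) (a b : ℤ) (q : ℕ) : ℂ :=
  (((2 * q * k₂ : ℕ) : ℂ) ^ 2)⁻¹ *
    ∑ r ∈ Finset.Icc 1 (2 * q * k₂), ∑ s ∈ Finset.Icc 1 (2 * q * k₂),
      expc ((a : ℝ) / q * r * s +
        (b : ℝ) / (2 * q * k₂) * ((k₁ : ℝ) * (r : ℝ) ^ 2 + (k₂ : ℝ) * (s : ℝ) ^ 2))

/-- `F(ξ) = ∫₀¹ e(−ξ x²) dx`. -/
noncomputable def Ffactor (ξ : ℝ) : ℂ := ∫ x in (0 : ℝ)..1, expc (-(ξ * x ^ 2))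

theorem expc_add (x y : ℝ) : expc (x + y) = expc x * expc y := by
  unfold expc
  rw [← Complex.exp_add]
  push_cast
  ring_nf

theorem norm_expc (x : ℝ) : ‖expc x‖ = 1 := by
  unfold expc
  have h : 2 * (Real.pi : ℂ) * Complex.I * x = ((2 * Real.pi * x : ℝ) : ℂ) * Complex.I := by
    push_cast
    ring
  rw [h, Complex.norm_exp_ofReal_mul_I]

theorem expc_intCast (n : ℤ) : expc n = 1 := by
  unfold expc
  rw [Complex.exp_eq_one_iff]
  exact ⟨n, by push_cast; ring⟩

theorem expc_add_intCast (x : ℝ) (n : ℤ) : expc (x + n) = expc x := by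
  rw [expc_add, expc_intCast, mul_one]

theorem continuous_expc : Continuous expc := by
  unfold expc
  fun_prop

theorem norm_expc_sub_expc_le (x y : ℝ) : ‖expc x - expc y‖ ≤ 2 * Real.pi * |x - y| := by
  have h : expc x - expc y = expc y * (expc (x - y) - 1) := by
    rw [mul_sub, ← expc_add, mul_one, add_sub_cancel]
  have h' : expc (x - y) = Complex.exp (Complex.I * ((2 * Real.pi * (x - y) : ℝ) : ℂ)) := by
    unfold expc
    push_cast
    ring_nf
  rw [h, norm_mul, norm_expc, one_mul, h']
  refine Real.norm_exp_I_mul_ofReal_sub_one_le.trans_eq ?_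
  rw [Real.norm_eq_abs, abs_mul, abs_of_pos Real.two_pi_pos]

/-- On `[0, 1]` the function `z ↦ e(-ξ z²)` is Lipschitz with constant `4π|ξ|`. -/
theorem norm_expc_sq_sub_le (ξ : ℝ) {z w : ℝ} (hz : z ∈ Set.Icc (0 : ℝ) 1)
    (hw : w ∈ Set.Icc (0 : ℝ) 1) :
    ‖expc (-(ξ * z ^ 2)) - expc (-(ξ * w ^ 2))‖ ≤ 4 * Real.pi * |ξ| * |z - w| := by
  refine (norm_expc_sub_expc_le _ _).trans ?_
  have h : -(ξ * z ^ 2) - -(ξ * w ^ 2) = -(ξ * ((z + w) * (z - w))) := by ring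
  have h2 : |z + w| ≤ 2 := by
    rw [abs_of_nonneg (by linarith [hz.1, hw.1])]
    linarith [hz.2, hw.2]
  rw [h, abs_neg, abs_mul, abs_mul]
  calc 2 * Real.pi * (|ξ| * (|z + w| * |z - w|))
      ≤ 2 * Real.pi * (|ξ| * (2 * |z - w|)) := by gcongr
    _ = 4 * Real.pi * |ξ| * |z - w| := by ring

theorem sum_range_mul_eq {E : Type*} [AddCommMonoid E] (h : ℕ → E) (d B : ℕ) :
    ∑ i ∈ Finset.range (d * B), h i
      = ∑ j ∈ Finset.range B, ∑ r ∈ Finset.range d, h (d * j + r) := by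
  induction B with
  | zero => simp
  | succ B ih => rw [Nat.mul_succ, Finset.sum_range_add, ih, Finset.sum_range_succ]

/-- Multiplication by a unit permutes the residues modulo `d`. -/
theorem Function.Periodic.sum_range_mul_div_eq {E : Type*} [AddCommMonoid E] {W : ℝ → E}
    (hW : Function.Periodic W 1) {p : ℤ} {d : ℕ} (hd : 0 < d) (hpd : IsCoprime p (d : ℤ))
    (u : ℝ) :
    ∑ j ∈ Finset.range d, W (u + j * (p / d)) = ∑ i ∈ Finset.range d, W (u + i / d) := by
  have hd' : (0 : ℤ) < d := by exact_mod_cast hd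
  have hmem : ∀ j : ℕ, ((j * p) % (d : ℤ)).toNat ∈ Finset.range d := by
    intro j
    have h1 := Int.emod_lt_of_pos (j * p) hd'
    have h2 := Int.emod_nonneg (j * p) hd'.ne'
    rw [Finset.mem_range]
    omega
  have hinj : Set.InjOn (fun j : ℕ => ((j * p) % (d : ℤ)).toNat) (Finset.range d) := by
    intro j hj j' hj' h
    simp only [Finset.coe_range, Set.mem_Iio] at hj hj' h
    have h2 := Int.emod_nonneg (j * p) hd'.ne'
    have h2' := Int.emod_nonneg (j' * p) hd'.ne'
    have h3 : (j * p) % (d : ℤ) = (j' * p) % (d : ℤ) := by omega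
    have h4 : (d : ℤ) ∣ (j' - j) * p := by
      rw [sub_mul]
      exact Int.ModEq.dvd h3
    have h5 : (d : ℤ) ∣ (j' : ℤ) - j := hpd.symm.dvd_of_dvd_mul_right h4
    have h6 : (j' : ℤ) - j = 0 := by
      apply Int.eq_zero_of_abs_lt_dvd h5
      rw [abs_lt]
      omega
    omega
  refine Finset.sum_nbij (fun j : ℕ => ((j * p) % (d : ℤ)).toNat) (fun j _ => hmem j) hinj
    (Finset.surjOn_of_injOn_of_card_le _ (fun j _ => hmem j) hinj le_rfl) ?_
  intro j _
  have h2 := Int.emod_nonneg (j * p) hd'.ne'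
  have h3 : ((((j * p) % (d : ℤ)).toNat : ℕ) : ℝ) = (((j * p) % (d : ℤ) : ℤ) : ℝ) := by
    rw [← Int.cast_natCast, Int.toNat_of_nonneg h2]
  have h4 : ((j * p : ℤ) : ℝ) = d * ((j * p / (d : ℤ) : ℤ) : ℝ) + (((j * p) % (d : ℤ) : ℤ) : ℝ) := by
    exact_mod_cast (Int.mul_ediv_add_emod (j * p) d).symm
  have hd0 : (d : ℝ) ≠ 0 := by positivity
  have h5 : u + j * ((p : ℝ) / d)
      = u + (((j * p) % (d : ℤ)).toNat : ℕ) / d + ((j * p / (d : ℤ) : ℤ) : ℝ) := by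
    rw [h3]
    push_cast at h4
    field_simp
    linarith
  rw [h5]
  simpa using hW.int_mul ((j * p) / (d : ℤ)) (u + (((j * p) % (d : ℤ)).toNat : ℕ) / d)

/-- Koksma's inequality for a block of `d` consecutive points of the orbit of a rotation, when
the rotation number is close to a fraction of denominator `d`; the variation of `f` is controlled
by the increments of `V`. -/
theorem norm_sum_block_sub_integral_le {f : ℝ → ℂ} {V : ℝ → ℝ} {T : ℝ}
    (hf : Function.Periodic f 1) (hint : ∀ x y, IntervalIntegrable f volume x y)
    (hV : ∀ x y, x ≤ y → ‖f x - f y‖ ≤ V y - V x) (hT : ∀ x, V (x + 1) = V x + T)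
    {p : ℤ} {d : ℕ} (hd : 0 < d) (hpd : IsCoprime p (d : ℤ)) {α : ℝ}
    (hα : |α - p / d| ≤ 1 / (d : ℝ) ^ 2) (u : ℝ) :
    ‖∑ j ∈ Finset.range d, f (u + j * α) - d * ∫ x in (0 : ℝ)..1, f x‖ ≤ 2 * T := by
  have hd0 : (0 : ℝ) < d := by exact_mod_cast hd
  have hmono : Monotone V := fun x y h => by
    linarith [hV x y h, norm_nonneg (f x - f y)]
  have hW : Function.Periodic (fun c => ∫ x in c..(c + 1 / d), f x) 1 := by
    intro c
    have h := intervalIntegral.integral_comp_add_right (a := c) (b := c + 1 / d) f 1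
    simp only [hf _] at h
    simp only []
    rw [h]
    congr 1
    ring
  have hU : Function.Periodic (fun c => V (c + 1 / d) - V (c - 1 / d)) 1 := by
    intro c
    simp only []
    rw [show c + 1 + 1 / (d : ℝ) = c + 1 / d + 1 by ring,
      show c + 1 - 1 / (d : ℝ) = c - 1 / d + 1 by ring, hT, hT]
    ring
  have hWsum : ∑ j ∈ Finset.range d, ∫ x in (u + j * (p / d))..(u + j * (p / d) + 1 / d), f x
      = ∫ x in (0 : ℝ)..1, f x := by
    rw [hW.sum_range_mul_div_eq hd hpd u]
    have h := intervalIntegral.sum_integral_adjacent_intervals (f := f) (μ := volume)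
      (a := fun i : ℕ => u + i / d) (n := d) (fun i _ => hint _ _)
    have h1 : u + ((d : ℕ) : ℝ) / d = u + 1 := by rw [div_self hd0.ne']
    have h2 := hf.intervalIntegral_add_eq u 0
    simp only [h1] at h
    rw [Nat.cast_zero, zero_div, add_zero, h2, zero_add] at h
    rw [← h]
    refine Finset.sum_congr rfl fun i _ => ?_
    congr 1
    push_cast
    ring
  have hUsum : ∑ j ∈ Finset.range d,
      (V (u + j * (p / d) + 1 / d) - V (u + j * (p / d) - 1 / d)) = 2 * T := by
    rw [hU.sum_range_mul_div_eq hd hpd u]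
    have h1 := Finset.sum_range_sub (fun i : ℕ => V (u + i / d)) d
    have h2 := Finset.sum_range_sub (fun i : ℕ => V (u + i / d - 1 / d)) d
    have e1 : u + ((d : ℕ) : ℝ) / d = u + 1 := by rw [div_self hd0.ne']
    have e2 : u + 1 - 1 / (d : ℝ) = u - 1 / d + 1 := by ring
    simp only [e1, e2, hT, Nat.cast_zero, zero_div, add_zero, add_sub_cancel_left] at h1 h2
    rw [two_mul]
    nth_rewrite 1 [← h1]
    rw [← h2, ← Finset.sum_add_distrib]
    refine Finset.sum_congr rfl fun i _ => ?_
    have e3 : u + ((i + 1 : ℕ) : ℝ) / d = u + i / d + 1 / d := by push_cast; ring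
    have e4 : u + (i : ℝ) / d + 1 / d - 1 / d = u + i / d := by ring
    simp only [e3, e4]
    ring
  rw [← hWsum, Finset.mul_sum, ← Finset.sum_sub_distrib, ← hUsum]
  refine norm_sum_le_of_le _ fun j hj => ?_
  have hjd : (j : ℝ) ≤ d := by exact_mod_cast (Finset.mem_range.mp hj).le
  set c : ℝ := u + j * (p / d) with hc
  have hx : |u + j * α - c| ≤ 1 / d := by
    rw [show u + j * α - c = j * (α - p / d) by rw [hc]; ring, abs_mul, abs_of_nonneg (by positivity)]
    calc (j : ℝ) * |α - p / d| ≤ d * (1 / (d : ℝ) ^ 2) := by gcongr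
      _ = 1 / d := by field_simp
  rw [abs_le] at hx
  have hpos : (0 : ℝ) < 1 / d := by positivity
  have key : f (u + j * α) - d * ∫ x in c..(c + 1 / d), f x
      = d * ∫ x in c..(c + 1 / d), (f (u + j * α) - f x) := by
    rw [intervalIntegral.integral_sub (by simp) (hint _ _), intervalIntegral.integral_const,
      add_sub_cancel_left, mul_sub, Complex.real_smul]
    have hdc : (d : ℂ) ≠ 0 := by exact_mod_cast hd.ne'
    push_cast
    field_simp
  have hbound : ‖∫ x in c..(c + 1 / d), (f (u + j * α) - f x)‖
      ≤ (V (c + 1 / d) - V (c - 1 / d)) * |c + 1 / d - c| := by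
    refine intervalIntegral.norm_integral_le_of_norm_le_const fun x hx' => ?_
    rw [Set.uIoc_of_le (by linarith)] at hx'
    rcases le_total (u + j * α) x with h | h
    · refine (hV _ _ h).trans ?_
      linarith [hmono hx'.2, hmono (show c - 1 / d ≤ u + j * α by linarith)]
    · rw [norm_sub_rev]
      refine (hV _ _ h).trans ?_
      linarith [hmono (show c - 1 / d ≤ x by linarith [hx'.1]),
        hmono (show u + j * α ≤ c + 1 / d by linarith)]
  rw [key, norm_mul, Complex.norm_natCast]
  calc (d : ℝ) * ‖∫ x in c..(c + 1 / d), (f (u + j * α) - f x)‖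
      ≤ d * ((V (c + 1 / d) - V (c - 1 / d)) * |c + 1 / d - c|) := by gcongr
    _ = V (c + 1 / d) - V (c - 1 / d) := by
      rw [add_sub_cancel_left, abs_of_pos hpos]
      field_simp

/-- Equidistribution with error `O(√M)` for rotations by a badly approximable number. -/
theorem norm_sum_rotation_sub_integral_le {f : ℝ → ℂ} {V : ℝ → ℝ} {T : ℝ}
    (hf : Function.Periodic f 1) (hint : ∀ x y, IntervalIntegrable f volume x y)
    (hf1 : ∀ x, ‖f x‖ ≤ 1)
    (hV : ∀ x y, x ≤ y → ‖f x - f y‖ ≤ V y - V x) (hT : ∀ x, V (x + 1) = V x + T)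
    (hT0 : 0 ≤ T) {α A : ℝ} (hA : 0 < A)
    (hα : ∀ x : ℚ, 1 ≤ A * (x.den : ℝ) ^ 2 * |α - x|) (u : ℝ) (M : ℕ) :
    ‖∑ j ∈ Finset.range M, f (u + j * α) - M * ∫ x in (0 : ℝ)..1, f x‖
      ≤ √M * (2 * A * T + 2) := by
  rcases Nat.eq_zero_or_pos M with rfl | hM
  · simp
  set D := Nat.sqrt M with hD
  have hD0 : 0 < D := Nat.sqrt_pos.mpr hM
  obtain ⟨x, hx, hxD⟩ := Real.exists_rat_abs_sub_le_and_den_le α hD0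
  set d := x.den with hd
  have hd0 : 0 < d := x.den_pos
  have hdR : (0 : ℝ) < d := by exact_mod_cast hd0
  have hxDR : (d : ℝ) ≤ D := by exact_mod_cast hxD
  have hxe : (x : ℝ) = (x.num : ℝ) / d := by rw [hd]; exact Rat.cast_def x
  have hDd : (D : ℝ) + 1 ≤ A * d := by
    have h1 := hα x
    have h2 : A * (d : ℝ) ^ 2 * |α - x| ≤ A * (d : ℝ) ^ 2 * (1 / ((D + 1) * d)) := by gcongr
    have h3 : A * (d : ℝ) ^ 2 * (1 / ((D + 1) * d)) = A * d / (D + 1) := by field_simp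
    rw [h3] at h2
    have h4 := h1.trans h2
    rwa [le_div_iff₀ (by positivity), one_mul] at h4
  have hsqrt : √(M : ℝ) ≤ D + 1 := by
    rw [Real.sqrt_le_iff]
    refine ⟨by positivity, ?_⟩
    have h := (Nat.lt_succ_sqrt' M).le
    exact_mod_cast h
  have hsqrt' : (D : ℝ) ≤ √(M : ℝ) := Real.nat_sqrt_le_real_sqrt
  have happ : |α - x.num / d| ≤ 1 / (d : ℝ) ^ 2 := by
    rw [← hxe]
    refine hx.trans ?_
    rw [sq]
    gcongr
    linarith
  have hcop : IsCoprime x.num (d : ℤ) := Rat.isCoprime_num_den x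
  have hI : ‖∫ x in (0 : ℝ)..1, f x‖ ≤ 1 := by
    simpa using intervalIntegral.norm_integral_le_of_norm_le_const (a := 0) (b := 1) (C := 1)
      (f := f) (fun x _ => hf1 x)
  set J := ∫ x in (0 : ℝ)..1, f x with hJ
  set B := M / d with hB
  have hMd : M = d * B + M % d := (Nat.div_add_mod M d).symm
  have hdecomp : ∑ j ∈ Finset.range M, f (u + j * α) - M * J
      = ∑ i ∈ Finset.range B, (∑ r ∈ Finset.range d, f (u + (d * i : ℕ) * α + r * α) - d * J)
        + ∑ r ∈ Finset.range (M % d), (f (u + (d * B + r : ℕ) * α) - J) := by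
    have h1 : (M : ℂ) = d * B + (M % d : ℕ) := by exact_mod_cast hMd
    rw [Finset.sum_sub_distrib, Finset.sum_sub_distrib, Finset.sum_const, Finset.sum_const,
      Finset.card_range, Finset.card_range, nsmul_eq_mul, nsmul_eq_mul, h1]
    have h3 : ∑ j ∈ Finset.range M, f (u + j * α)
        = ∑ j ∈ Finset.range (d * B + M % d), f (u + j * α) := by rw [← hMd]
    rw [h3, Finset.sum_range_add, sum_range_mul_eq]
    have h2 : ∀ i r : ℕ, u + ((d * i : ℕ) : ℝ) * α + r * α = u + ((d * i + r : ℕ) : ℝ) * α := by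
      intro i r
      push_cast
      ring
    simp only [h2]
    ring
  have hblocks : ‖∑ i ∈ Finset.range B,
      (∑ r ∈ Finset.range d, f (u + (d * i : ℕ) * α + r * α) - d * J)‖ ≤ B * (2 * T) := by
    refine (norm_sum_le_of_le _ fun i _ =>
      norm_sum_block_sub_integral_le hf hint hV hT hd0 hcop happ _).trans_eq ?_
    simp
  have hrest : ‖∑ r ∈ Finset.range (M % d), (f (u + (d * B + r : ℕ) * α) - J)‖
      ≤ (M % d : ℕ) * 2 := by
    refine (norm_sum_le_of_le (f := fun r : ℕ => f (u + (d * B + r : ℕ) * α) - J)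
      (n := fun _ => (2 : ℝ)) _ fun r _ => ?_).trans_eq ?_
    · refine (norm_sub_le _ _).trans ?_
      linarith [hf1 (u + (d * B + r : ℕ) * α)]
    · simp
  have hBle : (B : ℝ) ≤ A * √M := by
    have h1 : (B : ℝ) * d ≤ M := by
      have := Nat.div_mul_le_self M d
      exact_mod_cast this
    have h2 : (M : ℝ) = √M * √M := (Real.mul_self_sqrt (by positivity)).symm
    have h3 : √(M : ℝ) * √M ≤ √M * (A * d) := by
      gcongr
      linarith
    refine le_of_mul_le_mul_right ?_ hdR
    linarith
  have hmod : ((M % d : ℕ) : ℝ) ≤ √M := by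
    have h : ((M % d : ℕ) : ℝ) ≤ d := by exact_mod_cast (Nat.mod_lt M hd0).le
    linarith
  rw [hdecomp]
  refine (norm_add_le _ _).trans ?_
  calc _ ≤ B * (2 * T) + (M % d : ℕ) * 2 := add_le_add hblocks hrest
    _ ≤ (A * √M) * (2 * T) + √M * 2 := by gcongr
    _ = √M * (2 * A * T + 2) := by ring

/-- Square roots of rational numbers are badly approximable. -/
theorem Irrational.sqrt_div_badly_approximable {k₁ k₂ : ℕ} (hk₂ : 0 < k₂)
    (hirr : Irrational (√((k₁ : ℝ) / k₂))) (x : ℚ) :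
    1 ≤ (k₂ * (2 * √((k₁ : ℝ) / k₂) + 1)) * (x.den : ℝ) ^ 2 * |√((k₁ : ℝ) / k₂) - x| := by
  set θ := √((k₁ : ℝ) / k₂) with hθ
  have hθ0 : 0 ≤ θ := Real.sqrt_nonneg _
  have hk : (1 : ℝ) ≤ k₂ := by exact_mod_cast hk₂
  have hd : (1 : ℝ) ≤ x.den := by exact_mod_cast x.den_pos
  rcases le_total 1 |θ - x| with h | h
  · have h1 : (1 : ℝ) ≤ k₂ * (2 * θ + 1) := by nlinarith
    have h2 : (1 : ℝ) ≤ (x.den : ℝ) ^ 2 := one_le_pow₀ hd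
    exact one_le_mul_of_one_le_of_one_le (one_le_mul_of_one_le_of_one_le h1 h2) h
  have hsq : θ ^ 2 = k₁ / k₂ := Real.sq_sqrt (by positivity)
  have hxe : (x : ℝ) = (x.num : ℝ) / x.den := Rat.cast_def x
  have hdx : (x.den : ℝ) * x = x.num := by
    rw [hxe]
    field_simp
  have hz : (((k₁ : ℤ) * (x.den : ℤ) ^ 2 - k₂ * x.num ^ 2 : ℤ) : ℝ)
      = k₂ * (θ + x) * (x.den : ℝ) ^ 2 * (θ - x) := by
    push_cast
    rw [← hdx]
    have : (k₁ : ℝ) = k₂ * θ ^ 2 := by rw [hsq]; field_simp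
    rw [this]
    ring
  have hne1 : θ - x ≠ 0 := sub_ne_zero.mpr (hirr.ne_rat x)
  have hne2 : θ + x ≠ 0 := by
    have := hirr.ne_rat (-x)
    push_cast at this
    intro h0
    exact this (by linarith)
  have hne : ((k₁ : ℤ) * (x.den : ℤ) ^ 2 - k₂ * x.num ^ 2 : ℤ) ≠ 0 := by
    intro h0
    rw [h0, Int.cast_zero] at hz
    have : k₂ * (θ + x) * (x.den : ℝ) ^ 2 * (θ - x) ≠ 0 := by positivity
    exact this hz.symm
  have h1 : (1 : ℝ) ≤ |(((k₁ : ℤ) * (x.den : ℤ) ^ 2 - k₂ * x.num ^ 2 : ℤ) : ℝ)| := by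
    exact_mod_cast Int.one_le_abs hne
  rw [hz, abs_mul, abs_mul, abs_mul, abs_of_nonneg (by positivity : (0 : ℝ) ≤ k₂),
    abs_of_nonneg (by positivity : (0 : ℝ) ≤ (x.den : ℝ) ^ 2)] at h1
  refine h1.trans ?_
  have h2 : |θ + x| ≤ 2 * θ + 1 := by
    rw [abs_le] at h ⊢
    constructor <;> linarith [h.1, h.2]
  gcongr

section FloorFract

variable {Q : ℕ} {ψ : ℤ → ℂ} (ξ : ℝ)

theorem periodic_floor_fract (hψ : ∀ m, ψ (m + Q) = ψ m) :
    Function.Periodic (fun y : ℝ => ψ ⌊Q * y⌋ * expc (-(ξ * Int.fract (Q * y) ^ 2))) 1 := by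
  intro y
  have h : (Q : ℝ) * (y + 1) = Q * y + Q := by ring
  simp only [h, Int.floor_add_natCast, Int.fract_add_natCast, hψ]

theorem norm_floor_fract_le (hψ1 : ∀ m, ‖ψ m‖ ≤ 1) (y : ℝ) :
    ‖ψ ⌊Q * y⌋ * expc (-(ξ * Int.fract (Q * y) ^ 2))‖ ≤ 1 := by
  rw [norm_mul, norm_expc, mul_one]
  exact hψ1 _

theorem intervalIntegrable_floor_fract (hψ1 : ∀ m, ‖ψ m‖ ≤ 1) (x y : ℝ) :
    IntervalIntegrable (fun y : ℝ => ψ ⌊Q * y⌋ * expc (-(ξ * Int.fract (Q * y) ^ 2)))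
      volume x y := by
  have hmeas : Measurable (fun y : ℝ => ψ ⌊Q * y⌋ * expc (-(ξ * Int.fract (Q * y) ^ 2))) := by
    have h0 : Measurable fun y : ℝ => (Q : ℝ) * y := by fun_prop
    have h1 : Measurable fun y : ℝ => ψ ⌊Q * y⌋ :=
      (measurable_from_top (f := ψ)).comp (Int.measurable_floor.comp h0)
    have h2 : Measurable fun y : ℝ => Int.fract (Q * y) := measurable_fract.comp h0
    exact h1.mul (continuous_expc.measurable.comp ((h2.pow_const 2).const_mul ξ).neg)
  refine (intervalIntegrable_const (c := (1 : ℝ))).mono_fun hmeas.aestronglyMeasurable ?_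
  filter_upwards with t
  simpa using norm_floor_fract_le ξ hψ1 t

theorem norm_floor_fract_sub_le (hψ1 : ∀ m, ‖ψ m‖ ≤ 1) (x y : ℝ) (hxy : x ≤ y) :
    ‖ψ ⌊Q * x⌋ * expc (-(ξ * Int.fract (Q * x) ^ 2))
        - ψ ⌊Q * y⌋ * expc (-(ξ * Int.fract (Q * y) ^ 2))‖
      ≤ (4 * Real.pi * |ξ| * (Q * y) + 2 * ⌊Q * y⌋) - (4 * Real.pi * |ξ| * (Q * x) + 2 * ⌊Q * x⌋) := by
  have hle : (Q : ℝ) * x ≤ Q * y := by gcongr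
  have hpi := Real.pi_pos
  have hL : 4 * Real.pi * |ξ| * (Q * x) ≤ 4 * Real.pi * |ξ| * (Q * y) := by gcongr
  rcases (Int.floor_mono hle).eq_or_lt with h | h
  · rw [← h, ← mul_sub, norm_mul]
    have h1 := norm_expc_sq_sub_le ξ (z := Int.fract (Q * x)) (w := Int.fract (Q * y))
      ⟨Int.fract_nonneg _, (Int.fract_lt_one _).le⟩ ⟨Int.fract_nonneg _, (Int.fract_lt_one _).le⟩
    have h2 : Int.fract ((Q : ℝ) * x) - Int.fract ((Q : ℝ) * y) = -(Q * y - Q * x) := by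
      simp only [Int.fract, h]
      ring
    rw [h2, abs_neg, abs_of_nonneg (by linarith : 0 ≤ (Q : ℝ) * y - Q * x)] at h1
    calc _ ≤ 1 * (4 * Real.pi * |ξ| * (Q * y - Q * x)) := by gcongr; exact hψ1 _
      _ = _ := by ring
  · have h1 : ((⌊(Q : ℝ) * x⌋ : ℤ) : ℝ) + 1 ≤ ⌊(Q : ℝ) * y⌋ := by exact_mod_cast h
    refine (norm_sub_le _ _).trans ?_
    linarith [norm_floor_fract_le (Q := Q) ξ hψ1 x, norm_floor_fract_le (Q := Q) ξ hψ1 y]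

theorem integral_floor_fract (hQ : 0 < Q) (hψ1 : ∀ m, ‖ψ m‖ ≤ 1) :
    ∫ y in (0 : ℝ)..1, ψ ⌊Q * y⌋ * expc (-(ξ * Int.fract (Q * y) ^ 2))
      = (Q : ℂ)⁻¹ * ∑ s ∈ Finset.range Q, ψ s * Ffactor ξ := by
  have hQ0 : (Q : ℝ) ≠ 0 := by positivity
  rw [intervalIntegral.integral_comp_mul_left
    (fun y : ℝ => ψ ⌊y⌋ * expc (-(ξ * Int.fract y ^ 2))) hQ0, mul_zero, mul_one,
    Complex.real_smul, Complex.ofReal_inv, Complex.ofReal_natCast]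
  congr 1
  have hint : ∀ x y, IntervalIntegrable
      (fun y : ℝ => ψ ⌊y⌋ * expc (-(ξ * Int.fract y ^ 2))) volume x y := by
    intro x y
    simpa using intervalIntegrable_floor_fract (Q := 1) ξ hψ1 x y
  have h := intervalIntegral.sum_integral_adjacent_intervals
    (f := fun y : ℝ => ψ ⌊y⌋ * expc (-(ξ * Int.fract y ^ 2))) (μ := volume)
    (a := fun i : ℕ => (i : ℝ)) (n := Q) (fun i _ => hint _ _)
  rw [Nat.cast_zero] at h
  rw [← h]
  refine Finset.sum_congr rfl fun s _ => ?_
  have h1 : ∫ y in (s : ℝ)..((s + 1 : ℕ) : ℝ), ψ ⌊y⌋ * expc (-(ξ * Int.fract y ^ 2))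
      = ∫ y in (s : ℝ)..((s + 1 : ℕ) : ℝ), ψ s * expc (-(ξ * (y - s) ^ 2)) := by
    refine intervalIntegral.integral_congr_Ioo_of_le (by push_cast; linarith) fun y hy => ?_
    have hfl : ⌊y⌋ = (s : ℤ) := by
      rw [Int.floor_eq_iff]
      push_cast at hy ⊢
      exact ⟨hy.1.le, hy.2⟩
    simp only [Int.fract, hfl, Int.cast_natCast]
  rw [h1, intervalIntegral.integral_const_mul,
    intervalIntegral.integral_comp_sub_right (fun y => expc (-(ξ * y ^ 2)))]
  push_cast
  rw [sub_self, add_sub_cancel_left, Ffactor]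

end FloorFract

/-- The arithmetic part of the phase, a function on `ℤ²` periodic modulo `2qk₂`. -/
noncomputable def arithPhase (k₁ k₂ : ℕ) (a b : ℤ) (q : ℕ) (n m : ℤ) : ℂ :=
  expc ((a : ℝ) / q * n * m +
    (b : ℝ) / (2 * q * k₂) * ((k₁ : ℝ) * (n : ℝ) ^ 2 + (k₂ : ℝ) * (m : ℝ) ^ 2))

section ArithPhase

variable {k₁ k₂ : ℕ} {a b : ℤ} {q : ℕ}

theorem norm_arithPhase (n m : ℤ) : ‖arithPhase k₁ k₂ a b q n m‖ = 1 := norm_expc _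

theorem arithPhase_add_left (hk₂ : 0 < k₂) (hq : 0 < q) (n m : ℤ) :
    arithPhase k₁ k₂ a b q (n + (2 * q * k₂ : ℕ)) m = arithPhase k₁ k₂ a b q n m := by
  unfold arithPhase
  refine Eq.trans ?_ (expc_add_intCast _ (2 * a * k₂ * m + b * k₁ * (2 * n + 2 * q * k₂)))
  congr 1
  push_cast
  field_simp
  ring

theorem arithPhase_add_right (hk₂ : 0 < k₂) (hq : 0 < q) (n m : ℤ) :
    arithPhase k₁ k₂ a b q n (m + (2 * q * k₂ : ℕ)) = arithPhase k₁ k₂ a b q n m := by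
  unfold arithPhase
  refine Eq.trans ?_ (expc_add_intCast _ (2 * a * k₂ * n + b * k₂ * (2 * m + 2 * q * k₂)))
  congr 1
  push_cast
  field_simp
  ring

theorem arithPhase_add_mul_left (hk₂ : 0 < k₂) (hq : 0 < q) (n m : ℤ) (j : ℕ) :
    arithPhase k₁ k₂ a b q (n + ((2 * q * k₂ : ℕ) : ℤ) * j) m = arithPhase k₁ k₂ a b q n m := by
  have h : Function.Periodic (fun n => arithPhase k₁ k₂ a b q n m) ((2 * q * k₂ : ℕ) : ℤ) :=
    fun n => arithPhase_add_left hk₂ hq n m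
  rw [mul_comm]
  exact h.nat_mul j n

theorem expc_eq_arithPhase_mul (hk₂ : 0 < k₂) (hq : 0 < q) (n : ℤ) :
    expc ((((a : ℝ) + (b : ℝ) * √((k₁ : ℝ) / k₂)) / q) *
        ((n : ℝ) * (⌊(n : ℝ) * √((k₁ : ℝ) / k₂)⌋ : ℝ)))
      = arithPhase k₁ k₂ a b q n ⌊(n : ℝ) * √((k₁ : ℝ) / k₂)⌋ *
        expc (-((b : ℝ) / (2 * q) * Int.fract ((n : ℝ) * √((k₁ : ℝ) / k₂)) ^ 2)) := by
  unfold arithPhase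
  rw [← expc_add]
  congr 1
  have hsq : √((k₁ : ℝ) / k₂) ^ 2 = k₁ / k₂ := Real.sq_sqrt (by positivity)
  have hk : (k₁ : ℝ) = k₂ * √((k₁ : ℝ) / k₂) ^ 2 := by rw [hsq]; field_simp
  rw [Int.fract]
  set θ := √((k₁ : ℝ) / k₂)
  set m : ℝ := (⌊(n : ℝ) * θ⌋ : ℝ)
  rw [hk]
  field_simp
  ring

end ArithPhase

/-- A sum over a full period of a periodic function does not depend on the starting point. -/
theorem sum_range_add_int_of_periodic {E : Type*} [AddCommGroup E] {h : ℤ → E} {Q : ℕ}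
    (hh : ∀ n, h (n + Q) = h n) (c : ℤ) :
    ∑ r ∈ Finset.range Q, h (c + r) = ∑ r ∈ Finset.range Q, h r := by
  have step : ∀ c : ℤ, ∑ r ∈ Finset.range Q, h (c + 1 + r) = ∑ r ∈ Finset.range Q, h (c + r) := by
    intro c
    have h1 := Finset.sum_range_succ (fun r : ℕ => h (c + r)) Q
    have h2 := Finset.sum_range_succ' (fun r : ℕ => h (c + r)) Q
    rw [h1] at h2
    simp only [hh, Nat.cast_zero, add_zero, add_left_inj] at h2
    rw [h2]
    refine Finset.sum_congr rfl fun r _ => ?_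
    congr 1
    push_cast
    ring
  induction c with
  | zero => simp
  | succ i ih => rw [step, ih]
  | pred i ih => rw [← ih, ← step, sub_add_cancel]

theorem sum_Icc_one_of_periodic {E : Type*} [AddCommGroup E] {h : ℤ → E} {Q : ℕ}
    (hh : ∀ n, h (n + Q) = h n) :
    ∑ r ∈ Finset.Icc 1 Q, h r = ∑ r ∈ Finset.range Q, h r := by
  rw [← sum_range_add_int_of_periodic hh 1, Finset.range_eq_Ico]
  refine (Finset.sum_Ico_add' (fun r : ℕ => h r) 0 Q 1).symm.trans
    (Finset.sum_congr rfl fun r _ => ?_)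
  push_cast
  rw [add_comm]

theorem Gfactor_eq_sum_range {k₁ k₂ : ℕ} {a b : ℤ} {q : ℕ} (hk₂ : 0 < k₂) (hq : 0 < q) (c : ℤ) :
    Gfactor k₁ k₂ a b q = (((2 * q * k₂ : ℕ) : ℂ) ^ 2)⁻¹ *
      ∑ r ∈ Finset.range (2 * q * k₂), ∑ s ∈ Finset.range (2 * q * k₂),
        arithPhase k₁ k₂ a b q (c + r) s := by
  have h : Gfactor k₁ k₂ a b q = (((2 * q * k₂ : ℕ) : ℂ) ^ 2)⁻¹ *
      ∑ r ∈ Finset.Icc 1 (2 * q * k₂), ∑ s ∈ Finset.Icc 1 (2 * q * k₂),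
        arithPhase k₁ k₂ a b q r s := by
    simp only [Gfactor, arithPhase, Int.cast_natCast]
  rw [h]
  congr 1
  rw [sum_range_add_int_of_periodic
    (h := fun n => ∑ s ∈ Finset.range (2 * q * k₂), arithPhase k₁ k₂ a b q n s)
    (fun n => Finset.sum_congr rfl fun s _ => arithPhase_add_left hk₂ hq n s) c,
    ← sum_Icc_one_of_periodic
    (h := fun n => ∑ s ∈ Finset.range (2 * q * k₂), arithPhase k₁ k₂ a b q n s)
    (fun n => Finset.sum_congr rfl fun s _ => arithPhase_add_left hk₂ hq n s)]
  exact Finset.sum_congr rfl fun r _ => sum_Icc_one_of_periodic fun m =>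
    arithPhase_add_right hk₂ hq r m

theorem sum_Icc_int_eq_sum_range {E : Type*} [AddCommMonoid E] (h : ℤ → E) (lo hi : ℤ) :
    ∑ n ∈ Finset.Icc lo hi, h n = ∑ i ∈ Finset.range (Finset.Icc lo hi).card, h (lo + i) := by
  rw [Int.card_Icc, Int.Icc_eq_finset_map, Finset.sum_map]
  refine Finset.sum_congr rfl fun i _ => ?_
  simp

/-- The major arc approximation for one residue class modulo `2qk₂`. -/
theorem norm_sum_residue_class_sub_le {k₁ k₂ : ℕ} (hk₂ : 0 < k₂)
    (hirr : Irrational (√((k₁ : ℝ) / k₂))) (a b : ℤ) {q : ℕ} (hq : 0 < q) (c : ℤ) (M : ℕ) :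
    ‖∑ j ∈ Finset.range M,
        expc ((((a : ℝ) + (b : ℝ) * √((k₁ : ℝ) / k₂)) / q) *
          (((c + (2 * q * k₂ : ℕ) * j : ℤ) : ℝ) *
            (⌊((c + (2 * q * k₂ : ℕ) * j : ℤ) : ℝ) * √((k₁ : ℝ) / k₂)⌋ : ℝ)))
        - M * (((2 * q * k₂ : ℕ) : ℂ)⁻¹ * ∑ s ∈ Finset.range (2 * q * k₂),
            arithPhase k₁ k₂ a b q c s * Ffactor ((b : ℝ) / (2 * q)))‖
      ≤ √M * (2 * (k₂ * (2 * √((k₁ : ℝ) / k₂) + 1)) *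
          ((2 * q * k₂ : ℕ) * (4 * Real.pi * |(b : ℝ) / (2 * q)| + 2)) + 2) := by
  have hQ : 0 < 2 * q * k₂ := by positivity
  have hQ0 : ((2 * q * k₂ : ℕ) : ℝ) ≠ 0 := by exact_mod_cast hQ.ne'
  have hψ1 : ∀ m, ‖arithPhase k₁ k₂ a b q c m‖ ≤ 1 := fun m => (norm_arithPhase c m).le
  have hpi := Real.pi_pos
  have key := norm_sum_rotation_sub_integral_le
    (V := fun y => 4 * Real.pi * |(b : ℝ) / (2 * q)| * ((2 * q * k₂ : ℕ) * y)
      + 2 * ⌊((2 * q * k₂ : ℕ) : ℝ) * y⌋)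
    (T := (2 * q * k₂ : ℕ) * (4 * Real.pi * |(b : ℝ) / (2 * q)| + 2))
    (periodic_floor_fract ((b : ℝ) / (2 * q)) fun m => arithPhase_add_right hk₂ hq c m)
    (intervalIntegrable_floor_fract _ hψ1) (norm_floor_fract_le _ hψ1)
    (norm_floor_fract_sub_le _ hψ1)
    (fun x => by
      simp only [mul_add, mul_one, Int.floor_add_natCast]
      push_cast
      ring)
    (by positivity) (A := k₂ * (2 * √((k₁ : ℝ) / k₂) + 1)) (by positivity)
    (hirr.sqrt_div_badly_approximable hk₂) (c * √((k₁ : ℝ) / k₂) / (2 * q * k₂ : ℕ)) M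
  rw [integral_floor_fract _ hQ hψ1] at key
  refine le_of_eq_of_le ?_ key
  congr 2
  refine Finset.sum_congr rfl fun j _ => ?_
  have h1 : ((2 * q * k₂ : ℕ) : ℝ) *
      (c * √((k₁ : ℝ) / k₂) / (2 * q * k₂ : ℕ) + j * √((k₁ : ℝ) / k₂))
      = ((c + (2 * q * k₂ : ℕ) * j : ℤ) : ℝ) * √((k₁ : ℝ) / k₂) := by
    rw [mul_add, mul_div_cancel₀ _ hQ0]
    push_cast
    ring
  rw [h1, expc_eq_arithPhase_mul hk₂ hq, arithPhase_add_mul_left hk₂ hq]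

theorem norm_Ffactor_le (ξ : ℝ) : ‖Ffactor ξ‖ ≤ 1 := by
  simpa [Ffactor] using intervalIntegral.norm_integral_le_of_norm_le_const (a := 0) (b := 1)
    (C := 1) (f := fun x => expc (-(ξ * x ^ 2))) (fun x _ => (norm_expc _).le)

theorem norm_Gfactor_le {k₁ k₂ : ℕ} {a b : ℤ} {q : ℕ} (hk₂ : 0 < k₂) (hq : 0 < q) :
    ‖Gfactor k₁ k₂ a b q‖ ≤ 1 := by
  have hQ0 : (0 : ℝ) < ((2 * q * k₂ : ℕ) : ℝ) := by exact_mod_cast (by positivity : 0 < 2 * q * k₂)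
  rw [Gfactor_eq_sum_range hk₂ hq 0, norm_mul, norm_inv, norm_pow, Complex.norm_natCast,
    inv_mul_le_iff₀ (by positivity), mul_one]
  refine (norm_sum_le_of_le _ fun r _ => norm_sum_le_of_le _ fun s _ =>
    (norm_arithPhase _ _).le).trans_eq ?_
  simp [sq]

/-- The unnormalised major arc approximation. -/
theorem norm_sum_Icc_sub_card_mul_le {k₁ k₂ : ℕ} (hk₂ : 0 < k₂)
    (hirr : Irrational (√((k₁ : ℝ) / k₂))) (lo hi : ℤ) (a b : ℤ) {q : ℕ} (hq : 0 < q) :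
    ‖∑ n ∈ Finset.Icc lo hi, expc ((((a : ℝ) + (b : ℝ) * √((k₁ : ℝ) / k₂)) / q) *
          ((n : ℝ) * (⌊(n : ℝ) * √((k₁ : ℝ) / k₂)⌋ : ℝ)))
        - (Finset.Icc lo hi).card * (Gfactor k₁ k₂ a b q * Ffactor ((b : ℝ) / (2 * q)))‖
      ≤ (2 * q * k₂ : ℕ) * (√(Finset.Icc lo hi).card * (2 * (k₂ * (2 * √((k₁ : ℝ) / k₂) + 1)) *
          ((2 * q * k₂ : ℕ) * (4 * Real.pi * |(b : ℝ) / (2 * q)| + 2)) + 2) + 2) := by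
  rw [sum_Icc_int_eq_sum_range]
  set N := (Finset.Icc lo hi).card
  set f : ℤ → ℂ := fun n => expc ((((a : ℝ) + (b : ℝ) * √((k₁ : ℝ) / k₂)) / q) *
    ((n : ℝ) * (⌊(n : ℝ) * √((k₁ : ℝ) / k₂)⌋ : ℝ))) with hf
  set F := Ffactor ((b : ℝ) / (2 * q)) with hF
  set E := 2 * (k₂ * (2 * √((k₁ : ℝ) / k₂) + 1)) *
          ((2 * q * k₂ : ℕ) * (4 * Real.pi * |(b : ℝ) / (2 * q)| + 2)) + 2 with hE
  have hpi := Real.pi_pos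
  have hE0 : 0 ≤ E := by positivity
  have hclass : ∀ (c : ℤ) (M : ℕ), ‖∑ j ∈ Finset.range M, f (c + (2 * q * k₂ : ℕ) * j)
      - M * (((2 * q * k₂ : ℕ) : ℂ)⁻¹ * ∑ s ∈ Finset.range (2 * q * k₂),
          arithPhase k₁ k₂ a b q c s * F)‖ ≤ √M * E :=
    fun c M => norm_sum_residue_class_sub_le hk₂ hirr a b hq c M
  have hG := Gfactor_eq_sum_range (k₁ := k₁) (a := a) (b := b) hk₂ hq lo
  have hGF : ‖Gfactor k₁ k₂ a b q * F‖ ≤ 1 := by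
    rw [norm_mul]
    exact mul_le_one₀ (norm_Gfactor_le hk₂ hq) (norm_nonneg _) (norm_Ffactor_le _)
  have hQ : 0 < 2 * q * k₂ := by positivity
  generalize 2 * q * k₂ = Q at hclass hG hQ ⊢
  have hQ0 : (Q : ℂ) ≠ 0 := by exact_mod_cast hQ.ne'
  have hNQ : N = Q * (N / Q) + N % Q := (Nat.div_add_mod N Q).symm
  have hMN : N / Q ≤ N := Nat.div_le_self N Q
  have hRQ : N % Q ≤ Q := (Nat.mod_lt N hQ).le
  generalize N / Q = M at hNQ hMN
  generalize N % Q = R at hNQ hRQ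
  have hdecomp : ∑ i ∈ Finset.range N, f (lo + i) - N * (Gfactor k₁ k₂ a b q * F)
      = ∑ r ∈ Finset.range Q, (∑ j ∈ Finset.range M, f (lo + r + Q * j)
          - M * ((Q : ℂ)⁻¹ * ∑ s ∈ Finset.range Q, arithPhase k₁ k₂ a b q (lo + r) s * F))
        + ∑ i ∈ Finset.range R, (f (lo + (Q * M + i : ℕ)) - Gfactor k₁ k₂ a b q * F) := by
    have h1 : ∑ r ∈ Finset.range Q, M * ((Q : ℂ)⁻¹ *
        ∑ s ∈ Finset.range Q, arithPhase k₁ k₂ a b q (lo + r) s * F)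
        = Q * M * (Gfactor k₁ k₂ a b q * F) := by
      simp only [← Finset.mul_sum, ← Finset.sum_mul]
      rw [hG]
      field_simp
    have h2 : (N : ℂ) = Q * M + R := by exact_mod_cast hNQ
    rw [Finset.sum_sub_distrib, Finset.sum_sub_distrib, h1, h2]
    conv_lhs => rw [hNQ]
    rw [Finset.sum_range_add, sum_range_mul_eq (fun i : ℕ => f (lo + i)), Finset.sum_comm]
    have h3 : ∀ r j : ℕ, lo + ((Q * j + r : ℕ) : ℤ) = lo + r + Q * j := by
      intro r j
      push_cast
      ring
    simp only [h3, Finset.sum_const, Finset.card_range, nsmul_eq_mul]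
    ring
  rw [hdecomp]
  have hb1 : ‖∑ r ∈ Finset.range Q, (∑ j ∈ Finset.range M, f (lo + r + Q * j)
      - M * ((Q : ℂ)⁻¹ * ∑ s ∈ Finset.range Q, arithPhase k₁ k₂ a b q (lo + r) s * F))‖
      ≤ Q * (√N * E) := by
    refine (norm_sum_le_of_le (Finset.range Q) fun r _ => hclass (lo + r) M).trans ?_
    rw [Finset.sum_const, Finset.card_range, nsmul_eq_mul]
    gcongr
  have hb2 : ‖∑ i ∈ Finset.range R, (f (lo + (Q * M + i : ℕ)) - Gfactor k₁ k₂ a b q * F)‖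
      ≤ Q * 2 := by
    refine (norm_sum_le_of_le (n := fun _ => (2 : ℝ)) _ fun i _ => ?_).trans ?_
    · refine (norm_sub_le _ _).trans ?_
      have : ‖f (lo + (Q * M + i : ℕ))‖ = 1 := norm_expc _
      linarith
    · rw [Finset.sum_const, Finset.card_range, nsmul_eq_mul]
      gcongr
  refine (norm_add_le _ _).trans ?_
  linarith

/-- **Major arc approximation at `t = 0`** (Proposition: `t = 0`).
Let `k = k₁/k₂` be a positive rational in lowest terms with `√k` irrational.  Then there is
`C = C(k) > 0` such that for every nonempty finite interval `I = {lo, …, hi} ⊆ ℤ`, every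
`a, b ∈ ℤ` and every `q ∈ ℕ`,
`| 𝔼_{n∈I} e(((a+b√k)/q) n⌊n√k⌋) − G_k(a,b,q) F(b/(2q)) |
  ≤ C q² (1+|b|)(1+log|I|) |I|^{−1/2}`. -/
theorem major_arc_approximation_t_eq_zero
    (k₁ k₂ : ℕ) (hk₁ : 0 < k₁) (hk₂ : 0 < k₂) (hcop : Nat.Coprime k₁ k₂)
    (hirr : Irrational (Real.sqrt ((k₁ : ℝ) / k₂))) :
    ∃ C > 0, ∀ (lo hi : ℤ), lo ≤ hi → ∀ (a b : ℤ) (q : ℕ), 0 < q →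
      ‖(((Finset.Icc lo hi).card : ℝ) : ℂ)⁻¹ * (∑ n ∈ Finset.Icc lo hi,
            expc ((((a : ℝ) + (b : ℝ) * Real.sqrt ((k₁ : ℝ) / k₂)) / q) *
              ((n : ℝ) * (⌊(n : ℝ) * Real.sqrt ((k₁ : ℝ) / k₂)⌋ : ℝ))))
          - Gfactor k₁ k₂ a b q * Ffactor ((b : ℝ) / (2 * q))‖
        ≤ C * (q : ℝ) ^ 2 * (1 + |(b : ℝ)|) *
            (1 + Real.log ((Finset.Icc lo hi).card : ℝ)) *
            ((Finset.Icc lo hi).card : ℝ) ^ (-(1 / 2 : ℝ)) := by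
  set θ := √((k₁ : ℝ) / k₂) with hθ
  have hθ0 : 0 ≤ θ := Real.sqrt_nonneg _
  have hpi := Real.pi_gt_three
  have hkR : (1 : ℝ) ≤ k₂ := by exact_mod_cast hk₂
  set A : ℝ := k₂ * (2 * θ + 1) with hA
  have hA0 : 0 < A := by positivity
  refine ⟨4 * (k₂ : ℝ) ^ 2 * (4 * Real.pi * A + 4), by positivity, ?_⟩
  intro lo hi hlohi a b q hq
  have hmain := norm_sum_Icc_sub_card_mul_le (k₁ := k₁) hk₂ hirr lo hi a b hq
  rw [← hθ, ← hA] at hmain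
  have hcard : 0 < (Finset.Icc lo hi).card := Finset.card_pos.mpr ⟨lo, by simpa using hlohi⟩
  set S := ∑ n ∈ Finset.Icc lo hi, expc ((((a : ℝ) + (b : ℝ) * θ) / q) *
    ((n : ℝ) * (⌊(n : ℝ) * θ⌋ : ℝ))) with hS
  set N := (Finset.Icc lo hi).card with hN
  set P := Gfactor k₁ k₂ a b q * Ffactor ((b : ℝ) / (2 * q)) with hP
  have hN1 : (1 : ℝ) ≤ N := by exact_mod_cast hcard
  have hNc : (N : ℂ) ≠ 0 := by exact_mod_cast hcard.ne'
  have hqR : (1 : ℝ) ≤ q := by exact_mod_cast hq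
  have hsN : 1 ≤ √(N : ℝ) := Real.one_le_sqrt.mpr hN1
  have hlog : 0 ≤ Real.log N := Real.log_nonneg hN1
  have hb0 : 0 ≤ |(b : ℝ)| := abs_nonneg _
  have hξ : |(b : ℝ) / (2 * q)| ≤ |(b : ℝ)| / 2 := by
    rw [abs_div, abs_of_pos (by positivity : (0 : ℝ) < 2 * q)]
    gcongr
    linarith
  have hQ1 : (1 : ℝ) ≤ ((2 * q * k₂ : ℕ) : ℝ) := by
    exact_mod_cast (by positivity : 0 < 2 * q * k₂)
  have hQe : ((2 * q * k₂ : ℕ) : ℝ) = 2 * q * k₂ := by push_cast; ring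
  set Q : ℝ := ((2 * q * k₂ : ℕ) : ℝ) with hQ
  have hbound : ‖S - N * P‖
      ≤ 4 * (k₂ : ℝ) ^ 2 * (4 * Real.pi * A + 4) * (q : ℝ) ^ 2 * (1 + |(b : ℝ)|) * √N := by
    have hQb : 1 ≤ Q * (1 + |(b : ℝ)|) := one_le_mul_of_one_le_of_one_le hQ1 (by linarith)
    refine hmain.trans ?_
    calc Q * (√N * (2 * A * (Q * (4 * Real.pi * |(b : ℝ) / (2 * q)| + 2)) + 2) + 2)
        ≤ Q * (√N * (2 * A * (Q * (4 * Real.pi * (|(b : ℝ)| / 2) + 2 * Real.pi))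
            + 2 * (Q * (1 + |(b : ℝ)|))) + 2 * (√N * (Q * (1 + |(b : ℝ)|)))) := by
          gcongr
          · linarith
          · linarith
          · linarith [one_le_mul_of_one_le_of_one_le hsN hQb]
      _ = Q ^ 2 * (4 * Real.pi * A + 4) * (1 + |(b : ℝ)|) * √N := by ring
      _ = _ := by rw [hQe]; ring
  have hfac : (((N : ℝ) : ℂ))⁻¹ * S - P = (N : ℂ)⁻¹ * (S - N * P) := by
    rw [Complex.ofReal_natCast]
    field_simp
  have hpow : (N : ℝ) ^ (-(1 / 2 : ℝ)) = (N : ℝ)⁻¹ * √N := by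
    rw [Real.rpow_neg (by positivity), ← Real.sqrt_eq_rpow]
    have : √(N : ℝ) * √N = N := Real.mul_self_sqrt (by positivity)
    field_simp
    linarith
  rw [hfac, norm_mul, norm_inv, Complex.norm_natCast, hpow]
  calc (N : ℝ)⁻¹ * ‖S - N * P‖
      ≤ (N : ℝ)⁻¹ * (4 * (k₂ : ℝ) ^ 2 * (4 * Real.pi * A + 4) * (q : ℝ) ^ 2
          * (1 + |(b : ℝ)|) * √N) := by gcongr
    _ = 4 * (k₂ : ℝ) ^ 2 * (4 * Real.pi * A + 4) * (q : ℝ) ^ 2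
          * (1 + |(b : ℝ)|) * 1 * ((N : ℝ)⁻¹ * √N) := by ring
    _ ≤ _ := by
        gcongr
        linarith
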